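/- Let ξ be a countable ordinal with 1 ≤ ξ < ω₁ and let P ⊆ 2^ω be a Π^1_2 set. Then there exists a coanalytic set M ⊆ 2^ω × 2^ω such that P = {α ∈ 2^ω : M_α ∈ Σ^0_ξ(2^ω)}, and there exists a coanalytic set A ⊆ 2^ω × 2^ω such that P = {α ∈ 2^ω : A_α ∈ Π^0_ξ(2^ω)}. (Here M_α := {β : (α,β) ∈ M}.) -/

import Mathlib

open Topology MeasureTheory TopologicalSpace

abbrev Cantor : Type := ℕ → Fin 2

/-- The concatenation of the first `m` words of the sequence `a`. -/
def concatPrefix {β : Type*} (a : ℕ → List β) (m : ℕ) : List β :=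
  ((List.range m).map a).flatten

/-- The ω-power of a set `A` of finite words: the set of all infinite words obtained by
concatenating a sequence of words of `A` (infinitely many of them being nonempty). -/
def omegaPower {β : Type*} (A : Set (List β)) : Set (ℕ → β) :=
  {α | ∃ a : ℕ → List β, (∀ i, a i ∈ A) ∧
    (∀ n, ∃ m, n ≤ (concatPrefix a m).length) ∧
    ∀ (m k : ℕ) (h : k < (concatPrefix a m).length), (concatPrefix a m).get ⟨k, h⟩ = α k}

/-- The Borel class Σ⁰_ξ of a topological space: Σ⁰_ξ is the class of open sets for ξ ≤ 1,
and for ξ ≥ 2 it consists of the countable unions of sets each lying in some Π⁰_η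
with 1 ≤ η < ξ. -/
noncomputable def SigmaZero (X : Type*) [TopologicalSpace X] (ξ : Ordinal.{0}) : Set (Set X) :=
  if ξ ≤ 1 then {s | IsOpen s}
  else {s | ∃ f : ℕ → Set X,
    (∀ n, ∃ η : Ordinal.{0}, ∃ _ : 1 ≤ η, ∃ _ : η < ξ, (f n)ᶜ ∈ SigmaZero X η) ∧
    s = ⋃ n, f n}
termination_by ξ

/-- The Borel class Π⁰_ξ: complements of Σ⁰_ξ sets. -/
noncomputable def PiZero (X : Type*) [TopologicalSpace X] (ξ : Ordinal.{0}) : Set (Set X) :=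
  {s | sᶜ ∈ SigmaZero X ξ}

/-- A topological space is zero-dimensional if it has a basis consisting of clopen sets. -/
def ZeroDim (X : Type*) [TopologicalSpace X] : Prop :=
  ∃ b : Set (Set X), IsTopologicalBasis b ∧ ∀ s ∈ b, IsClopen s

/-- A set is coanalytic (Π¹₁) if its complement is analytic. -/
def Coanalytic {X : Type*} [TopologicalSpace X] (P : Set X) : Prop :=
  MeasureTheory.AnalyticSet Pᶜ

/-- A set is Σ¹₂ if it is the projection of a coanalytic subset of `X × ω^ω`. -/
def Sigma12 {X : Type*} [TopologicalSpace X] (P : Set X) : Prop :=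
  ∃ Q : Set (X × (ℕ → ℕ)), Coanalytic Q ∧ P = Prod.fst '' Q

/-- A set is Π¹₂ if its complement is Σ¹₂. -/
def Pi12 {X : Type*} [TopologicalSpace X] (P : Set X) : Prop :=
  Sigma12 Pᶜ

theorem SigmaZero.mem_of_isClopen {X : Type*} [TopologicalSpace X] {s : Set X}
    (hs : IsClopen s) (ξ : Ordinal.{0}) : s ∈ SigmaZero X ξ := by
  rw [SigmaZero]
  split_ifs with h
  · exact hs.isOpen
  · refine ⟨fun _ => s, fun _ => ⟨1, le_rfl, not_le.mp h, ?_⟩, (Set.iUnion_const s).symm⟩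
    rw [SigmaZero, if_pos le_rfl]
    exact hs.compl.isOpen

theorem SigmaZero.empty_mem (X : Type*) [TopologicalSpace X] (ξ : Ordinal.{0}) :
    ∅ ∈ SigmaZero X ξ :=
  SigmaZero.mem_of_isClopen isClopen_empty ξ

theorem SigmaZero.univ_mem (X : Type*) [TopologicalSpace X] (ξ : Ordinal.{0}) :
    Set.univ ∈ SigmaZero X ξ :=
  SigmaZero.mem_of_isClopen isClopen_univ ξ

theorem SigmaZero.measurableSet {X : Type*} [TopologicalSpace X] [MeasurableSpace X]
    [OpensMeasurableSpace X] {ξ : Ordinal.{0}} {s : Set X} (hs : s ∈ SigmaZero X ξ) :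
    MeasurableSet s := by
  induction ξ using WellFoundedLT.induction generalizing s with
  | ind ξ ih =>
    rw [SigmaZero] at hs
    split_ifs at hs with h
    · exact IsOpen.measurableSet hs
    · obtain ⟨f, hf, rfl⟩ := hs
      refine MeasurableSet.iUnion fun n => ?_
      obtain ⟨η, -, hη, hfn⟩ := hf n
      exact MeasurableSet.of_compl (ih η hη hfn)

/-- An analytic subset of a Hausdorff space is the projection of a closed set. -/
theorem MeasureTheory.AnalyticSet.exists_isClosed_image_fst {X : Type*} [TopologicalSpace X]
    [T2Space X] {s : Set X} (hs : AnalyticSet s) :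
    ∃ F : Set (X × (ℕ → ℕ)), IsClosed F ∧ s = Prod.fst '' F := by
  rw [AnalyticSet] at hs
  obtain rfl | ⟨f, hf, rfl⟩ := hs
  · exact ⟨∅, isClosed_empty, by simp⟩
  · refine ⟨{p | p.1 = f p.2}, isClosed_eq continuous_fst (hf.comp continuous_snd), ?_⟩
    ext x
    simp [eq_comm]

/-- The image of an analytic set under a Borel map is analytic. -/
theorem MeasureTheory.AnalyticSet.image_of_measurable {X Y : Type*}
    [TopologicalSpace X] [MeasurableSpace X] [BorelSpace X]
    [TopologicalSpace Y] [PolishSpace Y] [MeasurableSpace Y] [BorelSpace Y]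
    {s : Set X} (hs : AnalyticSet s) {f : X → Y} (hf : Measurable f) : AnalyticSet (f '' s) := by
  rw [AnalyticSet] at hs
  obtain rfl | ⟨g, hg, rfl⟩ := hs
  · simpa using analyticSet_empty
  · rw [← Set.range_comp, ← Set.image_univ]
    exact MeasurableSet.univ.analyticSet_image (hf.comp hg.measurable)

instance polishSpace_cantor : PolishSpace Cantor :=
  haveI : PolishSpace (Fin 2) := inferInstance
  inferInstance

/-- Diagonalizing against a universal analytic set yields a coanalytic set which is not Borel. -/
theorem exists_coanalytic_not_measurableSet :
    ∃ S : Set Cantor, Coanalytic S ∧ ¬ MeasurableSet S := by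
  obtain ⟨b, hb⟩ : ∃ b : ℕ → Set (Cantor × (ℕ → ℕ)), IsTopologicalBasis (Set.range b) := by
    obtain ⟨B, hBc, -, hB⟩ := exists_countable_basis (Cantor × (ℕ → ℕ))
    have hne : B.Nonempty := by
      by_contra h
      have hU := hB.sUnion_eq
      rw [Set.not_nonempty_iff_eq_empty.mp h, Set.sUnion_empty] at hU
      exact Set.empty_ne_univ hU
    obtain ⟨b, rfl⟩ := hBc.exists_eq_range hne
    exact ⟨b, hB⟩
  let F : Set (Cantor × (ℕ → ℕ)) := {p | ∀ n, p.1 n = 1 → p ∉ b n}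
  have hF : IsClosed F := by
    simp only [F, Set.ofPred_forall]
    refine isClosed_iInter fun n => ?_
    have hopen : IsOpen {p : Cantor × (ℕ → ℕ) | p.1 n = 1} :=
      (isOpen_discrete ({1} : Set (Fin 2))).preimage
        (show Continuous fun p : Cantor × (ℕ → ℕ) => p.1 n by fun_prop)
    have hbn : IsOpen (b n) := hb.isOpen (Set.mem_range_self n)
    exact isClosed_imp hopen hbn.isClosed_compl
  refine ⟨(Prod.fst '' F)ᶜ, ?_, fun hm => ?_⟩
  · rw [Coanalytic, compl_compl]
    exact hF.analyticSet.image_of_continuous continuous_fst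
  · obtain ⟨G, hG, hFG⟩ := hm.analyticSet.exists_isClosed_image_fst
    classical
    let c : Cantor := fun n => if b n ⊆ Gᶜ then 1 else 0
    have hc (y : ℕ → ℕ) : (c, y) ∈ F ↔ (c, y) ∈ G := by
      constructor
      · intro h
        by_contra hn
        obtain ⟨_, ⟨n, rfl⟩, hmem, hsub⟩ :=
          hb.exists_subset_of_mem_open (Set.mem_compl hn) hG.isOpen_compl
        exact h n (if_pos hsub) hmem
      · intro h n hn hmem
        have hsub : b n ⊆ Gᶜ := by
          by_contra hsub
          simp [c, hsub] at hn
        exact hsub hmem h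
    have hiff : c ∈ Prod.fst '' F ↔ c ∈ Prod.fst '' G := by
      simp [hc]
    rw [← hFG] at hiff
    exact iff_not_self hiff

/-- Every coanalytic subset of `2^ω × ω^ω` can be turned into a coanalytic subset of
`2^ω × 2^ω` whose section at `α` is empty or non-Borel, according to whether the section
of the original set is empty or not. -/
theorem exists_coanalytic_sections {Q : Set (Cantor × (ℕ → ℕ))} (hQ : Coanalytic Q)
    {S : Set Cantor} (hS : Coanalytic S) (hSm : ¬ MeasurableSet S) :
    ∃ M : Set (Cantor × Cantor), Coanalytic M ∧
      (∀ α, (∀ γ, (α, γ) ∉ Q) → {β | (α, β) ∈ M} = ∅) ∧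
      ∀ α γ, (α, γ) ∈ Q → ¬ MeasurableSet {β | (α, β) ∈ M} := by
  have hCantor : ¬ Countable Cantor := by
    rw [← Cardinal.mk_le_aleph0_iff]
    simp [Cardinal.aleph0_lt_continuum]
  have hProd : ¬ Countable ((ℕ → ℕ) × Cantor) := fun _ =>
    hCantor (Prod.snd_surjective (α := ℕ → ℕ)).countable
  let e : Cantor ≃ᵐ (ℕ → ℕ) × Cantor :=
    PolishSpace.measurableEquivOfNotCountable hCantor hProd
  let f : (Cantor × ((ℕ → ℕ) × Cantor)) ≃ᵐ Cantor × Cantor :=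
    (MeasurableEquiv.refl Cantor).prodCongr e.symm
  let R : Set (Cantor × ((ℕ → ℕ) × Cantor)) := {p | (p.1, p.2.1) ∈ Q ∧ p.2.2 ∈ S}
  have hR : AnalyticSet Rᶜ := by
    have hunion : Rᶜ = (fun p => (p.1, p.2.1)) ⁻¹' Qᶜ ∪ (fun p => p.2.2) ⁻¹' Sᶜ := by
      ext p
      simp only [R, Set.mem_compl_iff, Set.mem_ofPred_eq, Set.mem_union, Set.mem_preimage]
      tauto
    have hQ' := AnalyticSet.preimage (X := Cantor × ((ℕ → ℕ) × Cantor)) hQ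
      (f := fun p => (p.1, p.2.1)) (by fun_prop)
    have hS' := AnalyticSet.preimage (X := Cantor × ((ℕ → ℕ) × Cantor)) hS
      (f := fun p => p.2.2) (by fun_prop)
    rw [hunion, Set.union_eq_iUnion]
    exact AnalyticSet.iUnion (Bool.forall_bool.mpr ⟨hS', hQ'⟩)
  refine ⟨f '' R, ?_, fun α hα => ?_, fun α γ hγ hm => hSm ?_⟩
  · rw [Coanalytic, ← Set.image_compl_eq f.bijective]
    exact hR.image_of_measurable f.measurable
  · ext β
    simp only [Set.mem_ofPred_eq, Set.mem_empty_iff_false, iff_false]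
    rintro ⟨⟨α', γ, δ⟩, hp, heq⟩
    obtain rfl : α' = α := congrArg Prod.fst heq
    exact hα γ hp.1
  · have hsection : S = (fun δ => e.symm (γ, δ)) ⁻¹' {β | (α, β) ∈ f '' R} := by
      ext δ
      have hf : (α, e.symm (γ, δ)) = f (α, γ, δ) := rfl
      simp only [Set.mem_preimage, Set.mem_ofPred_eq, hf, f.injective.mem_set_image]
      simp [R, hγ]
    rw [hsection]
    exact (e.symm.measurable.comp measurable_prodMk_left) hm

/-- For every countable ordinal ξ ≥ 1 and every Π¹₂ set P ⊆ 2^ω, there is a coanalytic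
M ⊆ 2^ω × 2^ω with P = {α | M_α ∈ Σ⁰_ξ}, and a coanalytic A with P = {α | A_α ∈ Π⁰_ξ}. -/
theorem pi12_as_sections_class (ξ : Ordinal.{0}) (hξ : 1 ≤ ξ)
    (hcount : ξ.card ≤ Cardinal.aleph0)
    (P : Set Cantor) (hP : Pi12 P) :
    (∃ M : Set (Cantor × Cantor), Coanalytic M ∧
      P = {α : Cantor | {β | (α, β) ∈ M} ∈ SigmaZero Cantor ξ}) ∧
    (∃ A : Set (Cantor × Cantor), Coanalytic A ∧
      P = {α : Cantor | {β | (α, β) ∈ A} ∈ PiZero Cantor ξ}) := by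
  obtain ⟨Q, hQ, hPQ⟩ := hP
  obtain ⟨S, hS, hSm⟩ := exists_coanalytic_not_measurableSet
  obtain ⟨M, hM, hempty, hnonempty⟩ := exists_coanalytic_sections hQ hS hSm
  have hP_iff (α : Cantor) : α ∈ P ↔ ∀ γ, (α, γ) ∉ Q := by
    rw [← not_iff_not, ← Set.mem_compl_iff, hPQ]
    simp
  refine ⟨⟨M, hM, ?_⟩, ⟨M, hM, ?_⟩⟩
  · ext α
    rw [hP_iff]
    constructor
    · intro h
      simpa only [Set.mem_ofPred_eq, hempty α h] using SigmaZero.empty_mem Cantor ξ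
    · intro h γ hγ
      exact hnonempty α γ hγ (SigmaZero.measurableSet h)
  · ext α
    rw [hP_iff]
    constructor
    · intro h
      simpa only [Set.mem_ofPred_eq, hempty α h, PiZero, Set.compl_empty] using
        SigmaZero.univ_mem Cantor ξ
    · intro h γ hγ
      exact hnonempty α γ hγ (MeasurableSet.of_compl (SigmaZero.measurableSet h))
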